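/- arXiv:2409.07445 — 2 statements merged into one kernel-verified Lean document; each statement's English description precedes it below -/
import Mathlib

section
/- Let S be a nonempty set, 𝓕 an ultrafilter on S, 𝕜 a field, and 𝕜̃ := 𝕜^S/𝓕 the ultrapower, with 𝕜 embedded diagonally. Suppose f : S → 𝕜 is a function that is not constant on any subset of S belonging to 𝓕, and let x ∈ 𝕜̃ be the class of f. Then there exists a valuation v : 𝕜̃ → ℝ ∪ {∞} (meaning v(a) = ∞ iff a = 0, v(ab) = v(a) + v(b), and v(a+b) ≥ min{v(a),v(b)}) such that v(x) = 1 and v(a) = 0 for all a ∈ 𝕜*. -/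
/-- The ideal `I_𝓕` of an ultrafilter `𝓕` in a product of commutative rings; the quotient
by it is the ultraproduct. -/
def ultraIdeal {S : Type*} (F : Ultrafilter S) (k : S → Type*) [∀ s, CommRing (k s)] :
    Ideal (∀ s, k s) where
  carrier := {x | {s | x s = 0} ∈ (F : Filter S)}
  zero_mem' := by
    have h : {s | (0 : ∀ s, k s) s = 0} = Set.univ := by ext s; simp
    show {s | (0 : ∀ s, k s) s = 0} ∈ (F : Filter S)
    rw [h]
    exact Filter.univ_mem
  add_mem' := by
    intro a b ha hb
    apply Filter.mem_of_superset (Filter.inter_mem ha hb)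
    intro s hs
    simp only [Set.mem_inter_iff, Set.mem_setOf_eq] at hs ⊢
    simp [hs.1, hs.2]
  smul_mem' := by
    intro c x hx
    apply Filter.mem_of_superset hx
    intro s hs
    simp only [Set.mem_setOf_eq] at hs ⊢
    simp [hs]


open scoped LaurentSeries RatFunc Polynomial IntermediateField.algebraAdjoinAdjoin

@[reducible]
noncomputable def laurentRankOne (L : Type*) [Field L] :
    (Valued.v : Valuation L⸨X⸩ (WithZero (Multiplicative ℤ))).RankOne where
  hom' := (WithZeroMulInt.toNNReal (e := 2) (by norm_num)).comp
    (MonoidWithZeroHom.ValueGroup₀.embedding)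
  strictMono' := (WithZeroMulInt.toNNReal_strictMono (by norm_num)).comp
    MonoidWithZeroHom.ValueGroup₀.embedding_strictMono
  exists_val_nontrivial := by
    refine ⟨HahnSeries.single 1 1, ?_⟩
    rw [LaurentSeries.valuation_single_zpow]
    constructor
    · simp
    · intro h
      rw [← WithZero.exp_zero] at h
      simp at h

theorem exists_norm_closure (L : Type*) [Field L] :
    ∃ N : AlgebraicClosure L⸨X⸩ → ℝ, N 0 = 0 ∧ (∀ y, y ≠ 0 → 0 < N y) ∧
      (∀ y z, N (y * z) = N y * N z) ∧ (∀ y z, N (y + z) ≤ max (N y) (N z)) ∧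
      (∀ c : L, c ≠ 0 → N (algebraMap L⸨X⸩ _ (HahnSeries.C c)) = 1) ∧
      N (algebraMap L⸨X⸩ _ (HahnSeries.single 1 1)) < 1 := by
  let := laurentRankOne L
  let : NontriviallyNormedField L⸨X⸩ := Valued.toNontriviallyNormedField L⸨X⸩ (WithZero (Multiplicative ℤ))
  have : IsUltrametricDist L⸨X⸩ :=
    Valued.instIsUltrametricDist L⸨X⸩ (WithZero (Multiplicative ℤ))
  have : CompleteSpace L⸨X⸩ := LaurentSeries.instLaurentSeriesComplete
  refine ⟨spectralNorm L⸨X⸩ (AlgebraicClosure L⸨X⸩), spectralNorm_zero,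
    fun y hy => spectralNorm_zero_lt hy (Algebra.IsAlgebraic.isAlgebraic y),
    fun y z => spectralAlgNorm_mul y z, isNonarchimedean_spectralNorm, ?_, ?_⟩
  · have key : ∀ c : L, ‖(HahnSeries.C c : L⸨X⸩)‖ ≤ 1 := by
      intro c
      refine Valued.toNormedField.norm_le_one_iff.2 ?_
      have := (LaurentSeries.valuation_le_iff_coeff_lt_eq_zero L (D := 0)
        (f := (HahnSeries.C c : L⸨X⸩))).2 ?_
      · simpa using this
      · intro n hn
        simp [HahnSeries.C_apply, HahnSeries.coeff_single_of_ne hn.ne]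
    intro c hc
    rw [spectralNorm_extends]
    refine le_antisymm (key c) ?_
    have h1 := key c⁻¹
    have h2 : ‖(HahnSeries.C c : L⸨X⸩)‖ * ‖(HahnSeries.C c⁻¹ : L⸨X⸩)‖ = 1 := by
      rw [← norm_mul, ← map_mul, mul_inv_cancel₀ hc, map_one, norm_one]
    nlinarith [norm_nonneg (HahnSeries.C c : L⸨X⸩)]
  · rw [spectralNorm_extends]
    refine Valued.toNormedField.norm_lt_one_iff.2 ?_
    rw [LaurentSeries.valuation_single_zpow, ← WithZero.exp_zero, WithZero.exp_lt_exp]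
    norm_num

theorem exists_max_transc {k K : Type*} [Field k] [Field K] [Algebra k K] (x : K)
    (hx : Transcendental k x) :
    ∃ L : IntermediateField k K, Transcendental L x ∧
      ∃ B : Set K, (∀ b ∈ B, b = x ∨ b ∈ L) ∧ Algebra.IsAlgebraic (Algebra.adjoin k B) K := by
  obtain ⟨B, hB, hT⟩ := exists_isTranscendenceBasis_superset (R := k) (s := {x})
    ((algebraicIndependent_singleton_iff (⟨x, rfl⟩ : ({x} : Set K))).2 hx)
  have hxB : x ∈ B := hB rfl
  refine ⟨IntermediateField.adjoin k (B \ {x}), ?_, B, ?_, ?_⟩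
  · have := hT.1.transcendental_adjoin (s := {i | (i : K) ≠ x}) (i := ⟨x, hxB⟩) (by simp)
    have e : (fun i : B => (i : K)) '' {i | (i : K) ≠ x} = B \ {x} := by
      ext y; simp [and_comm]
    rw [e] at this
    intro h
    exact this ((IsFractionRing.isAlgebraic_iff (Algebra.adjoin k (B \ {x}))
      (IntermediateField.adjoin k (B \ {x})) K).2 h)
  · intro b hb
    by_cases h : b = x
    · exact Or.inl h
    · exact Or.inr (IntermediateField.subset_adjoin _ _ ⟨hb, h⟩)
  · have h := hT.isAlgebraic
    rwa [Subtype.range_coe] at h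

theorem exists_val {k K : Type*} [Field k] [Field K] [Algebra k K] (x : K)
    (hx : Transcendental k x) :
    ∃ v : K → WithTop ℝ, (∀ x, v x = ⊤ ↔ x = 0) ∧
      (∀ x y, v (x * y) = v x + v y) ∧
      (∀ x y, min (v x) (v y) ≤ v (x + y)) ∧ v x = 1 ∧
      (∀ a : k, a ≠ 0 → v (algebraMap k K a) = 0) := by
  obtain ⟨L, hL, B, hB, hA⟩ := exists_max_transc x hx
  obtain ⟨N, N0, Npos, Nmul, Nadd, Nc, NX⟩ := exists_norm_closure L
  have hinj : Function.Injective (Polynomial.aeval x : L[X] →ₐ[L] K) :=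
    transcendental_iff_injective.1 hL
  let φ : RatFunc L →+* K := RatFunc.liftRingHom (Polynomial.aeval x : L[X] →ₐ[L] K).toRingHom
    (nonZeroDivisors_le_comap_nonZeroDivisors_of_injective _ hinj)
  have φX : φ RatFunc.X = x := by
    simp [φ, RatFunc.liftRingHom_X]
  have φC : ∀ c : L, φ (RatFunc.C c) = c := by
    intro c
    simp only [φ]
    rw [RatFunc.liftRingHom_C]
    simp
  let : Algebra (RatFunc L) K := φ.toAlgebra
  have hrange : ∀ z ∈ Algebra.adjoin k B, z ∈ φ.range := by
    intro z hz
    induction hz using Algebra.adjoin_induction with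
    | mem z hz =>
      rcases hB z hz with rfl | h
      · exact ⟨_, φX⟩
      · exact ⟨_, φC ⟨z, h⟩⟩
    | algebraMap r => exact ⟨_, φC (algebraMap k L r)⟩
    | add a b _ _ ha hb => exact add_mem ha hb
    | mul a b _ _ ha hb => exact mul_mem ha hb
  have : Algebra.IsAlgebraic (RatFunc L) K := by
    refine ⟨fun y => ?_⟩
    obtain ⟨p, hp, hp0⟩ := hA.isAlgebraic y
    have hl : p.map (algebraMap (Algebra.adjoin k B) K) ∈ Polynomial.lifts φ := by
      rw [Polynomial.lifts_iff_coeff_lifts]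
      intro n
      rw [Polynomial.coeff_map]
      exact hrange _ (p.coeff n).2
    obtain ⟨q, hq⟩ := (Polynomial.mem_lifts _).1 hl
    refine ⟨q, ?_, ?_⟩
    · rintro rfl
      rw [Polynomial.map_zero] at hq
      exact hp ((Polynomial.map_eq_zero_iff Subtype.val_injective).1 hq.symm)
    · rw [Polynomial.aeval_def] at hp0 ⊢
      rw [← Polynomial.eval_map] at hp0 ⊢
      rw [← hq] at hp0
      exact hp0
  let ψ : K →ₐ[RatFunc L] AlgebraicClosure L⸨X⸩ := IsAlgClosed.lift
  have ψX : ψ x = algebraMap L⸨X⸩ _ (HahnSeries.single 1 1) := by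
    have := ψ.commutes RatFunc.X
    rw [IsScalarTower.algebraMap_apply (RatFunc L) L⸨X⸩ (AlgebraicClosure L⸨X⸩), RatFunc.coe_X] at this
    rw [← this]
    exact congrArg ψ φX.symm
  have ψC : ∀ c : L, ψ c = algebraMap L⸨X⸩ _ (HahnSeries.C c) := by
    intro c
    have := ψ.commutes (RatFunc.C c)
    rw [IsScalarTower.algebraMap_apply (RatFunc L) L⸨X⸩ (AlgebraicClosure L⸨X⸩)] at this
    have h2 : algebraMap (RatFunc L) L⸨X⸩ (RatFunc.C c) = HahnSeries.C c := by
      rw [← RatFunc.algebraMap_C, ← IsScalarTower.algebraMap_apply L[X] (RatFunc L) L⸨X⸩]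
      simp [HahnSeries.algebraMap_apply', PowerSeries.algebraMap_apply']
    rw [h2] at this
    rw [← this]
    exact congrArg ψ (φC c).symm
  have x0 : x ≠ 0 := by
    rintro rfl
    exact hx isAlgebraic_zero
  have ψ0 : ∀ y, y ≠ 0 → 0 < N (ψ y) := fun y hy =>
    Npos _ ((map_ne_zero_iff ψ ψ.toRingHom.injective).2 hy)
  have hl : Real.log (N (ψ x)) < 0 := Real.log_neg (ψ0 x x0) (by rw [ψX]; exact NX)
  classical
  refine ⟨fun y => if y = 0 then ⊤ else ((Real.log (N (ψ y)) / Real.log (N (ψ x)) : ℝ) : WithTop ℝ),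
    ?_, ?_, ?_, ?_, ?_⟩
  · intro y
    by_cases h : y = 0 <;> simp [h]
  · intro y z
    by_cases h : y = 0
    · simp [h]
    by_cases h' : z = 0
    · simp [h']
    simp only [h, h', mul_eq_zero, or_self, if_false, map_mul, Nmul]
    rw [Real.log_mul (ψ0 y h).ne' (ψ0 z h').ne', add_div, WithTop.coe_add]
  · intro y z
    by_cases h : y = 0
    · simp [h]
    by_cases h' : z = 0
    · simp [h']
    by_cases h'' : y + z = 0
    · simp [h'']
    simp only [h, h', h'', if_false, map_add]
    rw [← WithTop.coe_min, WithTop.coe_le_coe]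
    have hp := ψ0 _ h''
    rw [map_add] at hp
    rcases le_max_iff.1 (Nadd (ψ y) (ψ z)) with hh | hh
    · refine (min_le_left _ _).trans ?_
      exact div_le_div_of_nonpos_of_le hl.le (Real.log_le_log hp hh)
    · refine (min_le_right _ _).trans ?_
      exact div_le_div_of_nonpos_of_le hl.le (Real.log_le_log hp hh)
  · simp only [x0, if_false]
    rw [div_self hl.ne]
    rfl
  · intro a ha
    have ha' : algebraMap k L a ≠ 0 := by simpa using ha
    have h : algebraMap k K a ≠ 0 := by simpa using ha
    have h2 := ψC (algebraMap k L a)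
    have h3 : ((algebraMap k L a : L) : K) = algebraMap k K a := rfl
    rw [h3] at h2
    simp only [h, if_false]
    rw [h2, Nc _ ha']
    simp

/-- Lemma `val`(b).  If `f : S → 𝕜` is not constant on any member of the
ultrafilter `𝓕`, then the ultrapower `𝕜̃ = 𝕜^S/𝓕` carries a valuation
`v : 𝕜̃ → ℝ ∪ {∞}` with `v([f]) = 1` which is trivial on (the diagonal image of)
`𝕜^*`. -/
theorem statement_6 {S : Type*} [Nonempty S] (F : Ultrafilter S)
    (k : Type*) [Field k] (f : S → k)
    (hf : ∀ A ∈ F, ¬ ∃ c : k, ∀ s ∈ A, f s = c) :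
    ∃ v : ((S → k) ⧸ ultraIdeal F (fun _ => k)) → WithTop ℝ,
      (∀ x, v x = ⊤ ↔ x = 0) ∧
      (∀ x y, v (x * y) = v x + v y) ∧
      (∀ x y, min (v x) (v y) ≤ v (x + y)) ∧
      v (Ideal.Quotient.mk (ultraIdeal F (fun _ => k)) f) = 1 ∧
      (∀ a : k, a ≠ 0 →
        v (Ideal.Quotient.mk (ultraIdeal F (fun _ => k)) (fun _ => a)) = 0) := by
  have hmem : ∀ g : S → k, g ∈ ultraIdeal F (fun _ => k) ↔ {s | g s = 0} ∈ F := fun g => Iff.rfl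
  have hmax : (ultraIdeal F (fun _ : S => k)).IsMaximal := by
    rw [Ideal.isMaximal_iff]
    refine ⟨?_, ?_⟩
    · rw [hmem]
      have : {s : S | (1 : S → k) s = 0} = ∅ := by ext s; simp
      rw [this]
      exact F.empty_notMem
    · intro J g hJ hg hgJ
      rw [hmem, ← Ultrafilter.compl_mem_iff_notMem] at hg
      have h1 : (1 - g⁻¹ * g : S → k) ∈ ultraIdeal F (fun _ : S => k) := by
        rw [hmem]
        filter_upwards [hg] with s hs
        have hs' : g s ≠ 0 := hs
        simp [hs']
      have := J.add_mem (hJ h1) (J.mul_mem_left g⁻¹ hgJ)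
      simpa using this
  let : Field ((S → k) ⧸ ultraIdeal F (fun _ => k)) := Ideal.Quotient.field _
  have ht : Transcendental k (Ideal.Quotient.mk (ultraIdeal F (fun _ => k)) f) := by
    classical
    rintro ⟨p, hp, hp0⟩
    have h1 : (Polynomial.aeval f p : S → k) ∈ ultraIdeal F (fun _ => k) := by
      rw [← Ideal.Quotient.eq_zero_iff_mem, ← hp0]
      exact (Polynomial.aeval_algHom_apply (Ideal.Quotient.mkₐ k (ultraIdeal F (fun _ => k))) f p).symm
    rw [hmem] at h1
    have h2 : (⋃ c ∈ (p.roots.toFinset : Set k), {s | f s = c}) ∈ F := by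
      filter_upwards [h1] with s hs
      have hs' : (Polynomial.aeval f p : S → k) s = 0 := hs
      have h3 : (Polynomial.aeval f p : S → k) s = p.eval (f s) := by
        have := Polynomial.aeval_algHom_apply (Pi.evalAlgHom k (fun _ : S => k) s) f p
        simpa [Polynomial.aeval_def] using this.symm
      rw [h3] at hs'
      simp [hp, hs']
    rw [Ultrafilter.finite_biUnion_mem_iff (Finset.finite_toSet _)] at h2
    obtain ⟨c, _, hc⟩ := h2
    exact hf _ hc ⟨c, fun s hs => hs⟩
  obtain ⟨v, h1, h2, h3, h4, h5⟩ := exists_val _ ht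
  exact ⟨v, h1, h2, h3, h4, h5⟩
end

section
/- Let (J,Q,e) be a quadratic Jordan division algebra over a field 𝕜 satisfying the following (Zassenhaus) freeness condition: for every n ≥ 1 and all x, x_1, …, x_n ∈ J∖{0}, if xQ_{x_1}⋯Q_{x_n} = x then yQ_{x_1}⋯Q_{x_n} = y for all y ∈ J. Then Q_aQ_b = Q_bQ_a for all a, b ∈ J. -/
/-- The polarisation `Q_{a,b}` of a quadratic-type map. -/
def polarQ {J : Type*} [AddCommGroup J] (Q : J → J → J) (a b x : J) : J :=
  Q (a + b) x - Q a x - Q b x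

/-- A quadratic Jordan division algebra `(J, Q, e)` over a field `k` (operators act on
the right: `Q a x` denotes `xQ_a`). -/
structure IsQJDA (k : Type*) [Field k] (J : Type*) [AddCommGroup J] [Module k J]
    (Q : J → J → J) (e : J) : Prop where
  e_ne_zero : e ≠ 0
  add_right : ∀ a x y : J, Q a (x + y) = Q a x + Q a y
  smul_right : ∀ (a : J) (r : k) (x : J), Q a (r • x) = r • Q a x
  smul_left : ∀ (r : k) (a x : J), Q (r • a) x = (r * r) • Q a x
  polar_add_left : ∀ a b c x : J, polarQ Q (a + b) c x = polarQ Q a c x + polarQ Q b c x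
  polar_smul_left : ∀ (r : k) (a c x : J), polarQ Q (r • a) c x = r • polarQ Q a c x
  bijective : ∀ a : J, a ≠ 0 → Function.Bijective (Q a)
  Q_e : ∀ x, Q e x = x
  qj2 : ∀ a b x : J, polarQ Q a (Q a x) b = Q a (polarQ Q b x a)
  qj3 : ∀ a b x : J, Q (Q b a) x = Q b (Q a (Q b x))

namespace ZJ

variable {k : Type*} [Field k] {J : Type*} [AddCommGroup J] [Module k J]
  {Q : J → J → J} {e : J}

/-- the operator `V_a = Q_{a,e}` -/
def V (Q : J → J → J) (e a x : J) : J := polarQ Q a e x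

theorem Qz (h : IsQJDA k J Q e) (a : J) : Q a 0 = 0 := by
  have := h.add_right a 0 0
  simpa using this

theorem zQ (h : IsQJDA k J Q e) (x : J) : Q 0 x = 0 := by
  have := h.smul_left 0 0 x
  simpa using this

theorem Qneg (h : IsQJDA k J Q e) (a x : J) : Q a (-x) = - Q a x := by
  have := h.smul_right a (-1) x
  simpa using this

theorem negQ (h : IsQJDA k J Q e) (a x : J) : Q (-a) x = Q a x := by
  have := h.smul_left (-1) a x
  simpa using this

theorem Qsub (h : IsQJDA k J Q e) (a x y : J) : Q a (x - y) = Q a x - Q a y := by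
  rw [sub_eq_add_neg, h.add_right, Qneg h, ← sub_eq_add_neg]

theorem Qexp (Q : J → J → J) (a b x : J) : Q (a + b) x = Q a x + Q b x + polarQ Q a b x := by
  unfold polarQ; abel

theorem Pcomm (Q : J → J → J) (a b x : J) : polarQ Q a b x = polarQ Q b a x := by
  unfold polarQ; rw [add_comm a b]; abel

theorem Padd (h : IsQJDA k J Q e) (a b x y : J) :
    polarQ Q a b (x + y) = polarQ Q a b x + polarQ Q a b y := by
  unfold polarQ; simp only [h.add_right]; abel

theorem Pz (h : IsQJDA k J Q e) (a b : J) : polarQ Q a b 0 = 0 := by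
  unfold polarQ; simp only [Qz h]; abel

theorem Pconj (h : IsQJDA k J Q e) (a b c x : J) :
    polarQ Q (Q c a) (Q c b) x = Q c (polarQ Q a b (Q c x)) := by
  unfold polarQ
  rw [← h.add_right, h.qj3, h.qj3, h.qj3, Qsub h, Qsub h]

theorem Pe (h : IsQJDA k J Q e) (a b : J) : polarQ Q a b e = V Q e a b := by
  have := h.qj2 e b a
  rw [h.Q_e, h.Q_e] at this
  rw [V, Pcomm Q a e, this, Pcomm]

theorem Vcomm (h : IsQJDA k J Q e) (a b : J) : V Q e a b = V Q e b a := by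
  rw [← Pe h, Pcomm, Pe h]

theorem Vadd (h : IsQJDA k J Q e) (a x y : J) : V Q e a (x + y) = V Q e a x + V Q e a y :=
  Padd h _ _ _ _

theorem VQ (h : IsQJDA k J Q e) (a x : J) : V Q e a (Q a x) = Q a (V Q e a x) := by
  rw [← Pe h, h.qj2, Pcomm]
  rw [show polarQ Q x e a = V Q e x a from rfl, Vcomm h]

theorem PQe (h : IsQJDA k J Q e) (a x : J) : polarQ Q a (Q a e) x = Q a (V Q e a x) := by
  rw [h.qj2, show polarQ Q x e a = V Q e x a from rfl, Vcomm h]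

theorem exInv (h : IsQJDA k J Q e) (a : J) (ha : a ≠ 0) :
    ∃ a', a' ≠ 0 ∧ Q a a' = a ∧ (∀ x, Q a (Q a' x) = x) ∧ (∀ x, Q a' (Q a x) = x) := by
  obtain ⟨a', h1⟩ := (h.bijective a ha).2 a
  have h2 : ∀ x, Q a' (Q a x) = x := by
    intro x
    apply (h.bijective a ha).1
    rw [← h.qj3, h1]
  refine ⟨a', ?_, h1, ?_, h2⟩
  · rintro rfl
    rw [Qz h] at h1
    exact ha h1.symm
  · intro x
    obtain ⟨y, rfl⟩ := (h.bijective a ha).2 x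
    rw [h2]

theorem Vinv (h : IsQJDA k J Q e) {a a' : J} (h1 : Q a a' = a) (h2 : ∀ x, Q a (Q a' x) = x)
    (x : J) : Q a (V Q e a' x) = V Q e a x := by
  have := Pconj h a' e a (Q a' x)
  rw [h1, h2, PQe h, ← VQ h, h2] at this
  exact this.symm

theorem PVab (h : IsQJDA k J Q e) {a a' : J} (h1 : Q a a' = a) (h2 : ∀ x, Q a (Q a' x) = x)
    (x y : J) : Q a (polarQ Q a' y x) = polarQ Q a x y := by
  have e1 := Pconj h a' y a (Q a' x)
  rw [h1, h2, h.qj2] at e1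
  have e2 := h.qj2 a y (Q a' x)
  rw [h2] at e2
  rw [← e1, e2, Pcomm]

/-- The freeness condition. -/
def Free (Q : J → J → J) : Prop :=
  ∀ n : ℕ, 1 ≤ n → ∀ (x : J) (xs : Fin n → J), x ≠ 0 → (∀ i, xs i ≠ 0) →
      (List.ofFn xs).foldl (fun acc c => Q c acc) x = x →
      ∀ y : J, (List.ofFn xs).foldl (fun acc c => Q c acc) y = y

theorem free4 (hf : Free Q) {a b c d z : J} (ha : a ≠ 0) (hb : b ≠ 0) (hc : c ≠ 0) (hd : d ≠ 0)
    (hz : z ≠ 0) (hh : Q a (Q b (Q c (Q d z))) = z) (y : J) : Q a (Q b (Q c (Q d y))) = y := by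
  have := hf 4 (by norm_num) z ![d, c, b, a] hz
    (by intro i; fin_cases i <;> simp [ha, hb, hc, hd]) (by simpa [List.ofFn_succ] using hh) y
  simpa [List.ofFn_succ] using this

theorem Qne (h : IsQJDA k J Q e) {a x : J} (ha : a ≠ 0) (hx : x ≠ 0) : Q a x ≠ 0 := by
  intro h0
  apply hx
  apply (h.bijective a ha).1
  rw [h0, Qz h]

theorem comm_of_fix (h : IsQJDA k J Q e) (hf : Free Q) {a b z : J} (ha : a ≠ 0) (hb : b ≠ 0)
    (hz : z ≠ 0) (hh : Q a (Q b z) = Q b (Q a z)) (x : J) : Q a (Q b x) = Q b (Q a x) := by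
  obtain ⟨a', ha', -, a2, a3⟩ := exInv h a ha
  obtain ⟨b', hb', -, b2, b3⟩ := exInv h b hb
  have := free4 hf ha' hb' ha hb hz (by rw [hh, b3, a3]) x
  have t : Q b (Q a (Q a' (Q b' (Q a (Q b x))))) = Q b (Q a x) := by rw [this]
  rwa [a2, b2] at t

/-- `Q_u Q_v` and `Q_w` agree as soon as they agree at `e`. -/
theorem eq_of_e (h : IsQJDA k J Q e) (hf : Free Q) {u v w : J}
    (hh : Q u (Q v e) = Q w e) (x : J) : Q u (Q v x) = Q w x := by
  by_cases hw : w = 0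
  · subst hw
    rw [zQ h] at hh
    rw [zQ h]
    by_cases hu : u = 0
    · subst hu; rw [zQ h]
    by_cases hv : v = 0
    · subst hv; rw [zQ h, Qz h]
    exact absurd hh (Qne h hu (Qne h hv h.e_ne_zero))
  have hne := Qne h hw h.e_ne_zero
  have hu : u ≠ 0 := by
    rintro rfl; rw [zQ h] at hh; exact hne hh.symm
  have hv : v ≠ 0 := by
    rintro rfl; rw [zQ h, Qz h] at hh; exact hne hh.symm
  obtain ⟨w', hw', -, w2, w3⟩ := exInv h w hw
  have := free4 hf h.e_ne_zero hw' hu hv h.e_ne_zero (by rw [hh, w3, h.Q_e]) x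
  rw [h.Q_e] at this
  rw [← w2 (Q u (Q v x)), this]

theorem case_ne (h : IsQJDA k J Q e) (hf : Free Q) {a b : J} (ha : a ≠ 0) (hb : b ≠ 0)
    (ht : V Q e a b ≠ 0) (x : J) : Q a (Q b x) = Q b (Q a x) := by
  obtain ⟨a', ha', a1, a2, a3⟩ := exInv h a ha
  obtain ⟨b', hb', b1, b2, b3⟩ := exInv h b hb
  have key : Q a' (Q b' (V Q e a b)) = Q b' (Q a' (V Q e a b)) := by
    have e1 : Q b' (V Q e a b) = V Q e a b' := by
      rw [Vcomm h a b, ← Vinv h b1 b2, b3, Vcomm h]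
    have e2 : Q a' (V Q e a b) = V Q e a' b := by
      rw [← Vinv h a1 a2, a3]
    rw [e1, e2, ← Vinv h a1 a2, a3, Vcomm h a' b, ← Vinv h b1 b2, b3, Vcomm h]
  refine comm_of_fix h hf ha hb (Qne h ha' (Qne h hb' ht)) ?_ x
  rw [a2, b2, key, b2, a2]

theorem Paa (h : IsQJDA k J Q e) (a x : J) : polarQ Q a a x = Q a x + Q a x := by
  have := h.smul_left 2 a x
  rw [two_smul] at this
  unfold polarQ
  rw [this, show (2 * 2 : k) = 1 + 1 + 1 + 1 by norm_num]
  simp only [add_smul, one_smul]; abel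

theorem case_ne2 (h : IsQJDA k J Q e) (hf : Free Q) (h2 : (2 : k) ≠ 0) {a b : J} (ha : a ≠ 0)
    (hb : b ≠ 0) : V Q e a b ≠ 0 := by
  intro ht
  have hneg : ∀ x, polarQ Q a (-b) x = - polarQ Q a b x := by
    intro x
    have := h.polar_smul_left (-1) b a x
    rw [Pcomm Q a (-b), Pcomm Q a b]
    simpa using this
  have h0 := eq_of_e h hf (u := e) (v := a + b) (w := a + -b) (by
    rw [h.Q_e, Qexp Q, Qexp Q, hneg, Pe h, ht, negQ h]; simp)
  obtain ⟨a', ha', a1, a2, a3⟩ := exInv h a ha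
  have h3 : polarQ Q a b a' = b + b := by
    have s := PVab h a1 a2 b a'
    rw [← s, Paa h, h.add_right, a2]
  have h4 := h0 a'
  rw [h.Q_e, Qexp Q, Qexp Q, hneg, negQ h, h3] at h4
  have h5 : (2 : k) • ((2 : k) • b) = 0 := by
    rw [two_smul, two_smul]
    have := add_left_cancel h4
    nth_rewrite 1 [this]
    abel
  simp [h2, hb] at h5

section char2

theorem Ve (h : IsQJDA k J Q e) (h2 : ∀ x : J, x + x = 0) (a : J) : V Q e a e = 0 := by
  rw [Vcomm h, V, Paa h, h2]

theorem VV (h : IsQJDA k J Q e) (h2 : ∀ x : J, x + x = 0) (a x : J) :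
    V Q e a (V Q e a x) = V Q e (Q a e) x := by
  have e1 := h.qj3 e (a + e) x
  simp only [Qexp Q a e, h.Q_e] at e1
  rw [show polarQ Q a e e = V Q e a e from rfl, Ve h h2, add_zero, Qexp Q, h.qj3] at e1
  simp only [h.Q_e, h.add_right, ← V.eq_def, Vadd h, VQ h] at e1
  have e2 := h2 (Q a (V Q e a x))
  have e3 := h2 (Q a x)
  have e4 := h2 (V Q e a x)
  have e5 := h2 x
  have : V Q e a (V Q e a x) - V Q e (Q a e) x = -((Q a (V Q e a x) + Q a (V Q e a x)) +
    (Q a x + Q a x) + (V Q e a x + V Q e a x)) := by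
    rw [← sub_eq_zero] at e1 ⊢
    rw [← neg_eq_zero] at e1
    rw [← e1]; abel
  rw [e2, e3, e4] at this
  simpa [sub_eq_zero] using this

theorem Pcube (h : IsQJDA k J Q e) (hf : Free Q) (h2 : ∀ x : J, x + x = 0) {a : J} (ha : a ≠ 0)
    (x : J) : polarQ Q a x (Q a e) = V Q e (Q a a) x := by
  obtain ⟨a', ha', a1, a2, a3⟩ := exInv h a ha
  have z : Q a (V Q e a' (Q a e)) = 0 := by
    rw [Vinv h a1 a2, VQ h, Ve h h2, Qz h]
  have := eq_of_e h hf (u := a) (v := a' + Q a e) (w := e + Q a a) (by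
    rw [Qexp Q, Qexp Q, Pe h, Pe h, Vcomm h e, Ve h h2, h.add_right, h.add_right, z, a2, h.qj3, h.qj3,
      h.Q_e, h.Q_e]) x
  rw [Qexp Q, Qexp Q, h.add_right, h.add_right, a2, h.Q_e, h.qj3, h.qj3, h.Q_e, PVab h a1 a2,
    Pcomm Q e] at this
  exact add_left_cancel this

theorem Vcube (h : IsQJDA k J Q e) (hf : Free Q) (h2 : ∀ x : J, x + x = 0) {a b : J}
    (ht : V Q e a b = 0) : V Q e (Q a a) b = 0 := by
  have V0 : V Q e a 0 = 0 := Pz h _ _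
  have hc : ∀ x y : J, x + y + (x + y) = 0 := fun x y => h2 _
  have hVa2 : V Q e a (Q a e) = 0 := by rw [VQ h, Ve h h2, Qz h]
  have hVa4 : V Q e a (Q a (Q a e)) = 0 := by rw [VQ h, hVa2, Qz h]
  have ee : ∀ x, Q ((a + e) + Q a e) x = Q a x + x + V Q e a x + Q a (Q a x)
      + (Q a (V Q e a x) + V Q e (Q a e) x) := by
    intro x
    rw [Qexp Q, Qexp Q, h.qj3, h.Q_e, h.Q_e, h.polar_add_left, PQe h, Pcomm Q e]
    rfl
  have key := eq_of_e h hf (u := a + e) (v := (a + e) + Q a e) (w := Q a a + e) (by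
    rw [ee, ← VV h h2, Ve h h2, V0, Qz h, Qexp Q, Qexp Q, h.qj3, Pe h, h.Q_e, h.Q_e, ← V.eq_def]
    rw [Ve h h2]
    simp only [add_zero, h.add_right, Vadd h, hVa2, hVa4, Ve h h2]
    have e1 := h2 (Q a e)
    have e2 := h2 (Q a (Q a e))
    have : ∀ p q r s : J, p + p = 0 → q + q = 0 → q + p + r + (p + s + q) = r + s := by
      intro p q r s hp hq
      have : q + p + r + (p + s + q) = (p + p) + (q + q) + (r + s) := by abel
      rw [this, hp, hq]; simp
    exact this _ _ _ _ e1 e2) b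
  rw [ee, ← VV h h2, ht, V0, Qz h, Qexp Q, Qexp Q, h.qj3, h.Q_e, h.Q_e, ← V.eq_def, ← V.eq_def] at key
  simp only [add_zero, h.add_right, Vadd h, VQ h, ht, Qz h] at key
  have e1 := h2 (Q a b)
  have e2 := h2 (Q a (Q a b))
  have : ∀ p q r s v : J, p + p = 0 → q + q = 0 → q + p + r + (p + s + q) = r + s + v → v = 0 := by
    intro p q r s v hp hq hh
    have h3 : q + p + r + (p + s + q) = (p + p) + (q + q) + (r + s) := by abel
    rw [h3, hp, hq] at hh
    simpa using hh
  exact this _ _ _ _ _ e1 e2 key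

theorem case_char2 (h : IsQJDA k J Q e) (hf : Free Q) (h2 : ∀ x : J, x + x = 0) {a b : J}
    (ha : a ≠ 0) (hb : b ≠ 0) (ht : V Q e a b = 0) (x : J) : Q a (Q b x) = Q b (Q a x) := by
  refine comm_of_fix h hf ha hb h.e_ne_zero ?_ x
  have V0 : ∀ c, V Q e c 0 = 0 := fun c => Pz h _ _
  have ht' : V Q e b a = 0 := by rw [Vcomm h, ht]
  have hab : V Q e (Q a e) b = 0 := by rw [← VV h h2, ht, V0]
  have h22 : V Q e (Q a e) (Q b e) = 0 := by
    rw [Vcomm h, ← VV h h2, Vcomm h b (Q a e), hab, V0]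
  have e1 := h.qj3 e (a + b) e
  rw [h.Q_e, Qexp Q a b e, Pe h, ht, add_zero, Qexp Q, Pe h, h22, add_zero, h.qj3, h.qj3, h.Q_e,
    h.Q_e, Qexp Q, Padd h, Pcube h hf h2 ha, Vcube h hf h2 ht, Pcomm, Pcube h hf h2 hb,
    Vcube h hf h2 ht', h.add_right, h.add_right] at e1
  have e2 : Q a (Q b e) + Q b (Q a e) = 0 := by
    rw [← sub_eq_zero, ← neg_eq_zero] at e1
    rw [← e1]; abel
  have e3 := h2 (Q b (Q a e))
  exact add_right_cancel (e2.trans e3.symm)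

end char2

end ZJ



/-- Theorem `abelian`.  Let `(J,Q,e)` be a quadratic Jordan division
algebra satisfying the Zassenhaus freeness condition: whenever
`xQ_{x_1}⋯Q_{x_n} = x` for nonzero `x, x_1, …, x_n` (`n ≥ 1`), then
`yQ_{x_1}⋯Q_{x_n} = y` for all `y ∈ J`.  Then `Q_aQ_b = Q_bQ_a` for all `a, b ∈ J`. -/
theorem statement_19 {k : Type*} [Field k] {J : Type*} [AddCommGroup J] [Module k J]
    (Q : J → J → J) (e : J) (hQ : IsQJDA k J Q e)
    (hfree : ∀ n : ℕ, 1 ≤ n → ∀ (x : J) (xs : Fin n → J), x ≠ 0 → (∀ i, xs i ≠ 0) →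
      (List.ofFn xs).foldl (fun acc c => Q c acc) x = x →
      ∀ y : J, (List.ofFn xs).foldl (fun acc c => Q c acc) y = y) :
    ∀ a b x : J, Q a (Q b x) = Q b (Q a x) := by
  intro a b x
  by_cases ha : a = 0
  · subst ha
    rw [ZJ.zQ hQ, ZJ.zQ hQ, ZJ.Qz hQ]
  by_cases hb : b = 0
  · subst hb
    rw [ZJ.zQ hQ, ZJ.zQ hQ, ZJ.Qz hQ]
  by_cases ht : ZJ.V Q e a b = 0
  · by_cases h2 : (2 : k) = 0
    · refine ZJ.case_char2 hQ hfree (fun y => ?_) ha hb ht x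
      rw [← two_smul k, h2, zero_smul]
    · exact absurd ht (ZJ.case_ne2 hQ hfree h2 ha hb)
  · exact ZJ.case_ne hQ hfree ha hb ht x
end
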